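/- The Σ-protocol Σ_Partial has special soundness: let q be a prime, G a commutative group of order q with generator g, pk ∈ G a public key, and (u,v), (u,c) the common input. Suppose (X, U; e₁; z₁) and (X, U; e₂; z₂) are two accepting transcripts with the same commitment and distinct challenges e₁ ≠ e₂ in ℤ/qℤ, i.e., g^{z₁} = X·pk^{e₁}, u^{z₁} = U·(v·c^{-1})^{e₁}, g^{z₂} = X·pk^{e₂}, and u^{z₂} = U·(v·c^{-1})^{e₂}. Then the extracted value w = (z₁ − z₂)·(e₁ − e₂)^{-1} ∈ ℤ/qℤ is a valid witness: g^w = pk and u^w = v·c^{-1} (equivalently c = v·u^{-w}). -/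

import Mathlib

/-- Exponentiation of a group element by an exponent in `ZMod q`; for a group of
order `q` (so every element's order divides `q`) this is well defined as a
homomorphism in the exponent. -/
def gpow {G : Type*} [Group G] {q : ℕ} [NeZero q] (x : G) (e : ZMod q) : G :=
  x ^ e.val

theorem gpow_add {G : Type*} [Group G] {q : ℕ} [NeZero q] {x : G} (hx : x ^ q = 1)
    (a b : ZMod q) : gpow x (a + b) = gpow x a * gpow x b := by
  rw [gpow, gpow, gpow, ZMod.val_add, ← pow_eq_pow_mod _ hx, pow_add]

theorem gpow_mul {G : Type*} [Group G] {q : ℕ} [NeZero q] {x : G} (hx : x ^ q = 1)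
    (a b : ZMod q) : gpow x (a * b) = gpow (gpow x a) b := by
  rw [gpow, gpow, gpow, ZMod.val_mul, ← pow_eq_pow_mod _ hx, pow_mul]

theorem gpow_sub {G : Type*} [Group G] {q : ℕ} [NeZero q] {x : G} (hx : x ^ q = 1)
    (a b : ZMod q) : gpow x (a - b) = gpow x a * (gpow x b)⁻¹ := by
  rw [eq_mul_inv_iff_mul_eq, ← gpow_add hx, sub_add_cancel]

/-- Two accepting equations with a common commitment `X` and distinct challenges determine
the discrete logarithm of `y` to the base `x`. -/
theorem gpow_extract {q : ℕ} [Fact (Nat.Prime q)] {G : Type*} [CommGroup G] {x y X : G}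
    (hx : x ^ q = 1) (hy : y ^ q = 1) {e₁ e₂ z₁ z₂ : ZMod q} (hne : e₁ ≠ e₂)
    (h₁ : gpow x z₁ = X * gpow y e₁) (h₂ : gpow x z₂ = X * gpow y e₂) :
    gpow x ((z₁ - z₂) * (e₁ - e₂)⁻¹) = y := by
  have h : gpow x (z₁ - z₂) = gpow y (e₁ - e₂) := by
    rw [gpow_sub hx, gpow_sub hy, h₁, h₂, ← div_eq_mul_inv, ← div_eq_mul_inv,
      mul_div_mul_left_eq_div]
  have : Fact (1 < q) := ⟨(Fact.out : q.Prime).one_lt⟩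
  rw [gpow_mul hx, h, ← gpow_mul hy, mul_inv_cancel₀ (sub_ne_zero.mpr hne), gpow,
    ZMod.val_one, pow_one]

/-- Special soundness of the Σ-protocol Σ_Partial. -/
theorem sigmaPartial_specialSoundness
    (q : ℕ) [Fact (Nat.Prime q)]
    (G : Type*) [CommGroup G] [Fintype G] (hG : Fintype.card G = q)
    (g : G) (hg : ∀ x : G, x ∈ Subgroup.zpowers g)
    (pk u v c X U : G) (e₁ e₂ z₁ z₂ : ZMod q) (hne : e₁ ≠ e₂)
    (h1 : gpow g z₁ = X * gpow pk e₁) (h2 : gpow u z₁ = U * gpow (v * c⁻¹) e₁)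
    (h3 : gpow g z₂ = X * gpow pk e₂) (h4 : gpow u z₂ = U * gpow (v * c⁻¹) e₂) :
    gpow g ((z₁ - z₂) * (e₁ - e₂)⁻¹) = pk ∧
    gpow u ((z₁ - z₂) * (e₁ - e₂)⁻¹) = v * c⁻¹ := by
  have pow_q (x : G) : x ^ q = 1 := hG ▸ pow_card_eq_one
  exact ⟨gpow_extract (pow_q g) (pow_q pk) hne h1 h3,
    gpow_extract (pow_q u) (pow_q (v * c⁻¹)) hne h2 h4⟩
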